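/- If π : Γ → Δ is a tropical admissible cover and Δ is a metric tree (a metric graph of genus 0), then for every point x ∈ Δ one has rk(π*[x]) ≥ 1. -/

import Mathlib

open scoped Classical

noncomputable section

/-! ## Combinatorial models of metric graphs and their topological realizations -/

/-- A combinatorial model of a metric graph: a finite multigraph with positive
edge lengths. -/
structure CombGraph : Type 1 where
  V : Type
  E : Type
  fintypeV : Fintype V
  fintypeE : Fintype E
  src : E → V
  tgt : E → V
  len : E → ℝ
  len_pos : ∀ e, 0 < len e

attribute [instance] CombGraph.fintypeV CombGraph.fintypeE

namespace CombGraph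

variable (G : CombGraph)

instance : TopologicalSpace G.V := ⊥
instance : TopologicalSpace G.E := ⊥

/-- The disjoint union of the vertices and of the edges seen as real intervals,
before gluing. -/
def Pre : Type := G.V ⊕ (G.E × ℝ)

instance : TopologicalSpace G.Pre := inferInstanceAs (TopologicalSpace (G.V ⊕ (G.E × ℝ)))

/-- The predicate selecting legitimate points: a point of an edge `e` must have its
coordinate in `[0, len e]`. -/
def Ok : G.Pre → Prop
  | Sum.inl _ => True
  | Sum.inr p => 0 ≤ p.2 ∧ p.2 ≤ G.len p.1

/-- Points of the model before gluing. -/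
def PreR : Type := {p : G.Pre // G.Ok p}

instance : TopologicalSpace G.PreR := inferInstanceAs (TopologicalSpace {p : G.Pre // G.Ok p})

/-- The gluing relation: the endpoints of each edge are glued to the corresponding
vertices. -/
inductive Glue : G.PreR → G.PreR → Prop
  | srcGlue (e : G.E) :
      Glue ⟨Sum.inl (G.src e), trivial⟩ ⟨Sum.inr (e, 0), ⟨le_refl 0, (G.len_pos e).le⟩⟩
  | tgtGlue (e : G.E) :
      Glue ⟨Sum.inl (G.tgt e), trivial⟩ ⟨Sum.inr (e, G.len e), ⟨(G.len_pos e).le, le_refl _⟩⟩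

/-- The topological realization of the combinatorial model: the underlying
topological space of the associated metric graph. -/
def Space : Type := Quot G.Glue

instance : TopologicalSpace G.Space := inferInstanceAs (TopologicalSpace (Quot G.Glue))

/-- The point of the realization corresponding to a vertex. -/
def vertexPt (v : G.V) : G.Space := Quot.mk _ ⟨Sum.inl v, trivial⟩

/-- Clamping of a real coordinate into `[0, len e]`. -/
def clamp (e : G.E) (t : ℝ) : ℝ := max 0 (min t (G.len e))

/-- The point of the realization lying on the edge `e` at coordinate `t`
(the coordinate is clamped into `[0, len e]`). -/
def edgePt (e : G.E) (t : ℝ) : G.Space :=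
  Quot.mk _ ⟨Sum.inr (e, G.clamp e t),
    ⟨le_max_left 0 _, max_le (G.len_pos e).le (min_le_right _ _)⟩⟩

/-- The genus (first Betti number) of the (connected) metric graph. -/
def genus : ℤ := (Fintype.card G.E : ℤ) - (Fintype.card G.V : ℤ) + 1

/-! ### Outgoing directions, valence -/

/-- `d = (e, b)` is an outgoing unit tangent direction at the point `x`:
if `b = true` it points in the direction of increasing coordinate on `e`, if
`b = false` in the direction of decreasing coordinate. -/
def IsDir (x : G.Space) (d : G.E × Bool) : Prop :=
  if d.2 then ∃ t, 0 ≤ t ∧ t < G.len d.1 ∧ x = G.edgePt d.1 t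
  else ∃ t, 0 < t ∧ t ≤ G.len d.1 ∧ x = G.edgePt d.1 t

/-- The (finite) set of outgoing directions at a point. -/
def dirSet (x : G.Space) : Finset (G.E × Bool) :=
  Finset.univ.filter fun d => G.IsDir x d

/-- The valence of a point of the realization: the number of outgoing
directions at that point. -/
def valence (x : G.Space) : ℕ := (G.dirSet x).card

/-- The coordinate on the edge `d.1` of a point `x` admitting `d` as an outgoing
direction. -/
def dirCoord (x : G.Space) (d : G.E × Bool) : ℝ :=
  if d.2 then
    (if h : ∃ t, 0 ≤ t ∧ t < G.len d.1 ∧ x = G.edgePt d.1 t then h.choose else 0)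
  else
    (if h : ∃ t, 0 < t ∧ t ≤ G.len d.1 ∧ x = G.edgePt d.1 t then h.choose else 0)

/-- The point at distance `u` from `x` in the outgoing direction `d`. -/
def dirPt (x : G.Space) (d : G.E × Bool) (u : ℝ) : G.Space :=
  G.edgePt d.1 (G.dirCoord x d + (if d.2 then u else -u))

end CombGraph

/-! ### Rational functions and divisors -/

/-- A function `g : [0, L] → ℝ` is piecewise integral affine if there is a finite
subdivision of `[0, L]` on whose pieces `g` is affine with integral slope. -/
def PWIntAffine (g : ℝ → ℝ) (L : ℝ) : Prop :=
  ∃ (n : ℕ) (t : ℕ → ℝ) (m : ℕ → ℤ) (b : ℕ → ℝ),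
    t 0 = 0 ∧ t n = L ∧ (∀ i, i < n → t i < t (i + 1)) ∧
    (∀ i, i < n → ∀ u, t i ≤ u → u ≤ t (i + 1) → g u = (m i : ℝ) * u + b i)

/-- A rational function on the metric graph realizing `G`: a continuous function
which is piecewise integral affine on every edge. -/
structure RatFn (G : CombGraph) where
  toFun : G.Space → ℝ
  continuous : Continuous toFun
  piecewise : ∀ e : G.E, PWIntAffine (fun t => toFun (G.edgePt e t)) (G.len e)

namespace CombGraph

variable (G : CombGraph)

/-- The right-hand slope of a rational function on the edge `e` at coordinate `t`. -/
def rightSlope (f : RatFn G) (e : G.E) (t : ℝ) : ℝ :=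
  derivWithin (fun u => f.toFun (G.edgePt e u)) (Set.Ici t) t

/-- The left-hand slope of a rational function on the edge `e` at coordinate `t`. -/
def leftSlope (f : RatFn G) (e : G.E) (t : ℝ) : ℝ :=
  derivWithin (fun u => f.toFun (G.edgePt e u)) (Set.Iic t) t

/-- The order of a rational function at a point: the sum of its outgoing slopes. -/
def ordAt (f : RatFn G) (x : G.Space) : ℝ :=
  if h : ∃ v : G.V, x = G.vertexPt v then
    ∑ e : G.E,
      ((if G.src e = h.choose then G.rightSlope f e 0 else 0)
        + (if G.tgt e = h.choose then -(G.leftSlope f e (G.len e)) else 0))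
  else if h2 : ∃ p : G.E × ℝ, 0 < p.2 ∧ p.2 < G.len p.1 ∧ x = G.edgePt p.1 p.2 then
    G.rightSlope f h2.choose.1 h2.choose.2 - G.leftSlope f h2.choose.1 h2.choose.2
  else 0

/-- The group of divisors of the metric graph: the free abelian group on the
points of the realization. -/
abbrev Div (G : CombGraph) : Type := G.Space →₀ ℤ

/-- The degree of a divisor. -/
def degDiv (D : Div G) : ℤ := D.sum fun _ n => n

/-- A divisor is effective if all of its coefficients are nonnegative. -/
def Effective (D : Div G) : Prop := ∀ x, 0 ≤ D x

/-- `D` is the principal divisor associated to the rational function `f`. -/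
def IsPrincipal (D : Div G) (f : RatFn G) : Prop := ∀ x, (D x : ℝ) = G.ordAt f x

/-- Two divisors are linearly equivalent if their difference is principal. -/
def LinEquiv (D D' : Div G) : Prop := ∃ f : RatFn G, G.IsPrincipal (D - D') f

/-- The Baker–Norine rank of a divisor: the largest integer `k` such that for every
effective divisor `E` of degree `k` the linear system `|D - E|` is nonempty.  (For
negative `k` the condition is vacuous, so the supremum is `-1` exactly when
`|D|` is empty.) -/
def Rk (D : Div G) : ℤ :=
  sSup {k : ℤ | ∀ E : Div G, G.Effective E → G.degDiv E = k →
    ∃ E' : Div G, G.Effective E' ∧ G.LinEquiv (D - E) E'}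

/-- A point of a metric graph is a Weierstrass point if `rk(g·[x]) ≥ 1`. -/
def IsWeierstrass (x : G.Space) : Prop :=
  1 ≤ G.Rk (G.genus • Finsupp.single x 1)

/-- The canonical divisor of a metric graph. -/
def canonical : Div G :=
  ∑ v : G.V, ((G.valence (G.vertexPt v) : ℤ) - 2) • Finsupp.single (G.vertexPt v) 1

end CombGraph
/-! ### Tropical admissible covers -/

/-- A tropical admissible cover between the metric graphs realizing `G` and `D`:
a continuous surjective map with finite fibers which is locally integral affine
(witnessed by the data of the image direction `dirMap` and the absolute value
`slope` of the integral slope along every outgoing direction), such that the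
local degree is well defined at every point, and all Riemann–Hurwitz numbers are
nonnegative. -/
structure TropCover (G D : CombGraph) where
  toFun : G.Space → D.Space
  continuous : Continuous toFun
  surjective : Function.Surjective toFun
  finiteFibers : ∀ y : D.Space, (toFun ⁻¹' {y}).Finite
  dirMap : G.Space → G.E × Bool → D.E × Bool
  slope : G.Space → G.E × Bool → ℕ
  localDeg : G.Space → ℕ
  dirMap_isDir : ∀ x d, G.IsDir x d → D.IsDir (toFun x) (dirMap x d)
  locAffine : ∀ x d, G.IsDir x d → ∃ ε > (0 : ℝ), ∀ u, 0 ≤ u → u ≤ ε →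
      toFun (G.dirPt x d u) = D.dirPt (toFun x) (dirMap x d) ((slope x d : ℝ) * u)
  localDeg_spec : ∀ x d', D.IsDir (toFun x) d' →
      localDeg x = ∑ d ∈ (G.dirSet x).filter (fun d => dirMap x d = d'), slope x d
  rh_nonneg : ∀ x, 0 ≤ (G.valence x : ℤ) - 2 - (localDeg x : ℤ) * ((D.valence (toFun x) : ℤ) - 2)

namespace TropCover

variable {G D : CombGraph} (π : TropCover G D)

/-- The fiber of a point as a finite set. -/
def fiber (y : D.Space) : Finset G.Space := (π.finiteFibers y).toFinset

/-- The pullback `π*[y]` of the divisor `[y]`. -/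
def fiberDiv (y : D.Space) : CombGraph.Div G :=
  ∑ z ∈ π.fiber y, (π.localDeg z : ℤ) • Finsupp.single z 1

/-- The pullback morphism on divisors. -/
def pullback (A : CombGraph.Div D) : CombGraph.Div G :=
  A.sum fun y n => n • π.fiberDiv y

/-- The pushforward morphism on divisors. -/
def pushforward (A : CombGraph.Div G) : CombGraph.Div D :=
  Finsupp.mapDomain π.toFun A

/-- The degree of the cover, computed at the point `y` of the target. -/
def degAt (y : D.Space) : ℕ := ∑ z ∈ π.fiber y, π.localDeg z

/-- The Riemann–Hurwitz number of the cover at a point of the source. -/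
def rhNum (x : G.Space) : ℤ :=
  (G.valence x : ℤ) - 2 - (π.localDeg x : ℤ) * ((D.valence (π.toFun x) : ℤ) - 2)

/-- The (finite) set of points where the ramification divisor may be supported:
the vertices of the source together with the fibers of the vertices of the target
(at every other point the Riemann–Hurwitz number vanishes). -/
def ramSupport : Finset G.Space :=
  Finset.univ.image G.vertexPt ∪
    Finset.univ.biUnion fun v : D.V => π.fiber (D.vertexPt v)

/-- The ramification divisor `R_π = Σ_x r_π(x)·[x]` of the cover. -/
def ramDiv : CombGraph.Div G :=
  ∑ x ∈ π.ramSupport, π.rhNum x • Finsupp.single x 1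

end TropCover

/-! ### Piecewise integral affine functions on an interval -/

/-- The function `g` is affine with integral slope on `[a, b]`. -/
def IntAffineOn (g : ℝ → ℝ) (a b : ℝ) : Prop :=
  ∃ (m : ℤ) (c : ℝ), ∀ u, a ≤ u → u ≤ b → g u = m * u + c

/-- At every point of `[0, L]` the function `g` is affine on both sides, with outgoing slopes
`p` to the right and `q` to the left. -/
structure HasOneSidedSlopes (g : ℝ → ℝ) (L : ℝ) (p q : ℝ → ℤ) : Prop where
  right : ∀ t, 0 ≤ t → t < L → ∃ ε > (0 : ℝ), ∀ u, 0 ≤ u → u ≤ ε → g (t + u) = g t + p t * u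
  left : ∀ t, 0 < t → t ≤ L → ∃ ε > (0 : ℝ), ∀ u, 0 ≤ u → u ≤ ε → g (t - u) = g t + q t * u

namespace HasOneSidedSlopes

variable {g : ℝ → ℝ} {L : ℝ} {p q : ℝ → ℤ}

/-- A property propagating along the pieces on which `g` is affine propagates along `[0, L]`. -/
theorem induction (h : HasOneSidedSlopes g L p q) (hL : 0 ≤ L) {P : ℝ → Prop} (zero : P 0)
    (step : ∀ a b, 0 ≤ a → a < b → b ≤ L → IntAffineOn g a b → P a → P b) : P L := by
  set S : Set ℝ := {s | 0 ≤ s ∧ s ≤ L ∧ P s} with hS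
  have h0 : (0 : ℝ) ∈ S := ⟨le_rfl, hL, zero⟩
  have hbdd : BddAbove S := ⟨L, fun s hs => hs.2.1⟩
  have hs0 : 0 ≤ sSup S := le_csSup hbdd h0
  have hsL : sSup S ≤ L := csSup_le ⟨0, h0⟩ fun s hs => hs.2.1
  have hP : P (sSup S) := by
    rcases hs0.eq_or_lt with h' | h'
    · rwa [← h']
    obtain ⟨ε, hε, H⟩ := h.left _ h' hsL
    obtain ⟨b, hb, hlt⟩ := exists_lt_of_lt_csSup ⟨0, h0⟩ (sub_lt_self (sSup S) hε)
    rcases (le_csSup hbdd hb).eq_or_lt with hbs | hbs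
    · rw [← hbs]; exact hb.2.2
    refine step b _ hb.1 hbs hsL ⟨-q (sSup S), g (sSup S) + q (sSup S) * sSup S, ?_⟩ hb.2.2
    intro u hu1 hu2
    have := H (sSup S - u) (by linarith) (by linarith)
    rw [sub_sub_cancel] at this
    rw [this]; push_cast; ring
  rcases hsL.eq_or_lt with h' | h'
  · rwa [← h']
  obtain ⟨ε, hε, H⟩ := h.right _ hs0 h'
  have hlt : sSup S < min (sSup S + ε) L := lt_min (by linarith) h'
  have hmem : min (sSup S + ε) L ∈ S := by
    refine ⟨hs0.trans hlt.le, min_le_right _ _, step _ _ hs0 hlt (min_le_right _ _)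
      ⟨p (sSup S), g (sSup S) - p (sSup S) * sSup S, fun u hu1 hu2 => ?_⟩ hP⟩
    have := H (u - sSup S) (by linarith) (by linarith [min_le_left (sSup S + ε) L])
    rw [add_sub_cancel] at this
    rw [this]; ring
  exact absurd (le_csSup hbdd hmem) (not_le.mpr hlt)

theorem eq_of_affine (h : HasOneSidedSlopes g L p q) {a b : ℝ} (ha : 0 ≤ a) (hb : b ≤ L)
    {m : ℤ} {c : ℝ} (H : ∀ u, a ≤ u → u ≤ b → g u = m * u + c) :
    (∀ u, a ≤ u → u < b → p u = m) ∧ (∀ u, a < u → u ≤ b → q u = -m) := by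
  constructor
  · intro u hu1 hu2
    obtain ⟨ε, hε, H'⟩ := h.right u (by linarith) (by linarith)
    have hv : 0 < min ε (b - u) := lt_min hε (by linarith)
    have h1 := H' _ hv.le (min_le_left _ _)
    rw [H u hu1 hu2.le, H _ (by linarith) (by linarith [min_le_right ε (b - u)])] at h1
    have h2 : ((p u : ℝ) - m) * min ε (b - u) = 0 := by linarith
    have h3 := (mul_eq_zero.mp h2).resolve_right hv.ne'
    exact_mod_cast sub_eq_zero.mp h3
  · intro u hu1 hu2
    obtain ⟨ε, hε, H'⟩ := h.left u (by linarith) (by linarith)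
    have hv : 0 < min ε (u - a) := lt_min hε (by linarith)
    have h1 := H' _ hv.le (min_le_left _ _)
    rw [H u hu1.le hu2, H _ (by linarith [min_le_right ε (u - a)]) (by linarith)] at h1
    have h2 : ((q u : ℝ) + m) * min ε (u - a) = 0 := by linarith
    have h3 := (mul_eq_zero.mp h2).resolve_right hv.ne'
    exact_mod_cast eq_neg_of_add_eq_zero_left h3

/-- The outgoing slopes of `g` sum up to zero over the closed interval `[0, L]`. -/
theorem sum_slopes_eq_zero (h : HasOneSidedSlopes g L p q) (hL : 0 < L) {T : Finset ℝ}
    (hT : ∀ t ∈ T, 0 < t ∧ t < L) (hT' : ∀ t, 0 < t → t < L → t ∉ T → p t + q t = 0) :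
    p 0 + ∑ t ∈ T, (p t + q t) + q L = 0 := by
  have key : L = 0 ∨ p 0 + ∑ t ∈ T with t < L, (p t + q t) + q L = 0 := by
    refine h.induction hL.le
      (P := fun s => s = 0 ∨ p 0 + ∑ t ∈ T with t < s, (p t + q t) + q s = 0) (Or.inl rfl) ?_
    rintro a b ha hab hb ⟨m, c, H⟩ hPa
    obtain ⟨hp, hq⟩ := h.eq_of_affine ha hb H
    right
    have hpa := hp a le_rfl hab
    have hqb := hq b hab le_rfl
    rcases ha.eq_or_lt with rfl | ha0
    · rw [Finset.sum_eq_zero, hpa, hqb]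
      · ring
      · intro t ht
        rw [Finset.mem_filter] at ht
        rw [hp t (hT t ht.1).1.le ht.2, hq t (hT t ht.1).1 ht.2.le]; ring
    · replace hPa := hPa.resolve_left ha0.ne'
      have hsplit : ∑ t ∈ T with t < b, (p t + q t)
          = ∑ t ∈ T with t < a, (p t + q t) + (p a + q a) := by
        have h1 : ∑ t ∈ insert a T with t < b, (p t + q t) = ∑ t ∈ T with t < b, (p t + q t) := by
          refine (Finset.sum_subset (Finset.filter_subset_filter _ (Finset.subset_insert _ _))
            fun t ht ht' => ?_).symm
          simp only [Finset.mem_filter, Finset.mem_insert, not_and] at ht ht'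
          have htT : t ∉ T := fun h' => ht' h' ht.2
          obtain rfl : t = a := ht.1.resolve_right htT
          exact hT' t ha0 (by linarith) htT
        rw [← h1, ← Finset.sum_subset (s₁ := insert a {t ∈ T | t < a}), Finset.sum_insert (by simp),
          add_comm]
        · intro t ht
          simp only [Finset.mem_filter, Finset.mem_insert] at ht ⊢
          rcases ht with rfl | ht
          · exact ⟨Or.inl rfl, hab⟩
          · exact ⟨Or.inr ht.1, ht.2.trans hab⟩
        · intro t ht ht'
          simp only [Finset.mem_filter, Finset.mem_insert, not_or, not_and, not_lt] at ht ht'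
          have hta : a < t := lt_of_le_of_ne (ht'.2 (ht.1.resolve_left ht'.1)) (Ne.symm ht'.1)
          rw [hp t hta.le ht.2, hq t hta ht.2.le]; ring
      rw [hsplit, hqb]
      linarith
  have hfilter : ({t ∈ T | t < L} : Finset ℝ) = T := Finset.filter_true_of_mem fun t ht => (hT t ht).2
  simpa [hL.ne', hfilter] using key

theorem pwIntAffine (h : HasOneSidedSlopes g L p q) (hL : 0 ≤ L) : PWIntAffine g L := by
  refine h.induction hL (P := PWIntAffine g) ⟨0, fun _ => 0, 0, 0, rfl, rfl, ?_, ?_⟩ ?_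
  · simp
  · simp
  rintro a b ha hab hb ⟨m₁, c₁, H⟩ ⟨n, t, m, c, h0, hn, hlt, haff⟩
  refine ⟨n + 1, fun i => if i ≤ n then t i else b, fun i => if i < n then m i else m₁,
    fun i => if i < n then c i else c₁, by simp [h0], by simp, ?_, ?_⟩
  · intro i hi
    rcases (Nat.lt_succ_iff.mp hi).eq_or_lt with rfl | hi'
    · simp [hn, hab]
    · simpa [hi'.le, Nat.succ_le_of_lt hi'] using hlt i hi'
  · intro i hi u hu1 hu2
    rcases (Nat.lt_succ_iff.mp hi).eq_or_lt with rfl | hi'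
    · simp only [le_refl, if_true, hn] at hu1
      simp only [Nat.not_succ_le_self, if_false] at hu2
      simpa using H u hu1 hu2
    · simp only [hi'.le, Nat.succ_le_of_lt hi', if_true] at hu1 hu2
      simpa [hi'] using haff i hi' u hu1 hu2

end HasOneSidedSlopes

theorem PWIntAffine.exists_hasOneSidedSlopes {g : ℝ → ℝ} {L : ℝ} (h : PWIntAffine g L) :
    ∃ p q, HasOneSidedSlopes g L p q := by
  obtain ⟨n, t, m, c, h0, hn, -, haff⟩ := h
  have hright : ∀ s, 0 ≤ s ∧ s < L → ∃ i < n, t i ≤ s ∧ s < t (i + 1) := by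
    rintro s ⟨hs0, hsL⟩
    rw [← hn] at hsL
    clear haff hn
    induction n with
    | zero => linarith
    | succ k ih =>
      by_cases hk : s < t k
      · obtain ⟨i, hi, H⟩ := ih hk
        exact ⟨i, by omega, H⟩
      · exact ⟨k, by omega, not_lt.mp hk, hsL⟩
  have hleft : ∀ s, 0 < s ∧ s ≤ L → ∃ i < n, t i < s ∧ s ≤ t (i + 1) := by
    rintro s ⟨hs0, hsL⟩
    rw [← hn] at hsL
    clear haff hn hright
    induction n with
    | zero => linarith
    | succ k ih =>
      by_cases hk : s ≤ t k
      · obtain ⟨i, hi, H⟩ := ih hk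
        exact ⟨i, by omega, H⟩
      · exact ⟨k, by omega, not_le.mp hk, hsL⟩
  choose! i hi hi1 hi2 using hright
  choose! j hj hj1 hj2 using hleft
  refine ⟨fun s => m (i s), fun s => -m (j s), ⟨fun s hs0 hsL => ?_, fun s hs0 hsL => ?_⟩⟩
  · have h1 := hi1 s ⟨hs0, hsL⟩
    have h2 := hi2 s ⟨hs0, hsL⟩
    refine ⟨t (i s + 1) - s, by linarith, fun u hu1 hu2 => ?_⟩
    rw [haff _ (hi s ⟨hs0, hsL⟩) (s + u) (by linarith) (by linarith),
      haff _ (hi s ⟨hs0, hsL⟩) s h1 h2.le]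
    ring
  · have h1 := hj1 s ⟨hs0, hsL⟩
    have h2 := hj2 s ⟨hs0, hsL⟩
    refine ⟨s - t (j s), by linarith, fun u hu1 hu2 => ?_⟩
    rw [haff _ (hj s ⟨hs0, hsL⟩) (s - u) (by linarith) (by linarith),
      haff _ (hj s ⟨hs0, hsL⟩) s h1.le h2]
    push_cast
    ring

namespace CombGraph

variable {G : CombGraph}

/-! ### Points of the realization -/

/-- The normal form of a point before gluing: endpoints of edges are replaced by vertices. -/
def normalFormAux (x : G.PreR) : G.V ⊕ (G.E × ℝ) :=
  match x.1 with
  | Sum.inl v => Sum.inl v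
  | Sum.inr p =>
    if p.2 = 0 then Sum.inl (G.src p.1)
    else if p.2 = G.len p.1 then Sum.inl (G.tgt p.1) else Sum.inr p

/-- The normal form of a point of the realization. -/
def normalForm : G.Space → G.V ⊕ (G.E × ℝ) :=
  Quot.lift normalFormAux (by
    rintro _ _ (e | e)
    · simp [normalFormAux]
    · simp [normalFormAux, (G.len_pos e).ne'])

theorem clamp_eq {e : G.E} {t : ℝ} (h0 : 0 ≤ t) (h1 : t ≤ G.len e) : G.clamp e t = t := by
  simp [clamp, h0, h1]

@[simp]
theorem normalForm_vertexPt (v : G.V) : normalForm (G.vertexPt v) = Sum.inl v := rfl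

theorem normalForm_edgePt {e : G.E} {t : ℝ} (h0 : 0 ≤ t) (h1 : t ≤ G.len e) :
    normalForm (G.edgePt e t) = if t = 0 then Sum.inl (G.src e)
      else if t = G.len e then Sum.inl (G.tgt e) else Sum.inr (e, t) := by
  change (if G.clamp e t = 0 then _ else _) = _
  simp only [clamp_eq h0 h1]

theorem edgePt_eq_mk {e : G.E} {t : ℝ} (h0 : 0 ≤ t) (h1 : t ≤ G.len e) :
    G.edgePt e t = Quot.mk _ ⟨Sum.inr (e, t), h0, h1⟩ := by
  unfold edgePt
  congr 4
  exact clamp_eq h0 h1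

theorem edgePt_zero (e : G.E) : G.edgePt e 0 = G.vertexPt (G.src e) := by
  rw [edgePt_eq_mk le_rfl (G.len_pos e).le]
  exact (Quot.sound (Glue.srcGlue e)).symm

theorem edgePt_len (e : G.E) : G.edgePt e (G.len e) = G.vertexPt (G.tgt e) := by
  rw [edgePt_eq_mk (G.len_pos e).le le_rfl]
  exact (Quot.sound (Glue.tgtGlue e)).symm

theorem edgePt_clamp (e : G.E) (t : ℝ) : G.edgePt e (G.clamp e t) = G.edgePt e t :=
  edgePt_eq_mk (le_max_left 0 _) (max_le (G.len_pos e).le (min_le_right _ _))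

theorem edgePt_of_nonpos {e : G.E} {t : ℝ} (h : t ≤ 0) : G.edgePt e t = G.edgePt e 0 := by
  rw [← edgePt_clamp e t, clamp, min_eq_left (h.trans (G.len_pos e).le), max_eq_left h]

theorem edgePt_of_len_le {e : G.E} {t : ℝ} (h : G.len e ≤ t) :
    G.edgePt e t = G.edgePt e (G.len e) := by
  rw [← edgePt_clamp e t, clamp, min_eq_right h, max_eq_right (G.len_pos e).le]

theorem vertexPt_injective : Function.Injective G.vertexPt := fun v w h => by
  simpa using congrArg normalForm h

/-- Every point is a vertex or an interior point of an edge. -/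
theorem eq_vertexPt_or_eq_edgePt (x : G.Space) :
    (∃ v, x = G.vertexPt v) ∨ ∃ e t, 0 < t ∧ t < G.len e ∧ x = G.edgePt e t := by
  obtain ⟨⟨v | ⟨e, t⟩, hx⟩, rfl⟩ := Quot.exists_rep x
  · exact Or.inl ⟨v, rfl⟩
  · obtain ⟨h0, h1⟩ : 0 ≤ t ∧ t ≤ G.len e := hx
    have := edgePt_eq_mk h0 h1
    rcases h0.eq_or_lt with h0' | h0'
    · exact Or.inl ⟨G.src e, by rw [← edgePt_zero, ← this, h0']⟩
    rcases h1.eq_or_lt with h1' | h1'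
    · exact Or.inl ⟨G.tgt e, by rw [← edgePt_len, ← this, h1']⟩
    · exact Or.inr ⟨e, t, h0', h1', this.symm⟩

theorem edgePt_injOn_Ico (e : G.E) : Set.InjOn (G.edgePt e) (Set.Ico 0 (G.len e)) := by
  intro s hs t ht h
  have h' := congrArg normalForm h
  rw [normalForm_edgePt hs.1 hs.2.le, normalForm_edgePt ht.1 ht.2.le, if_neg hs.2.ne,
    if_neg ht.2.ne] at h'
  split_ifs at h' <;> simp_all

theorem edgePt_injOn_Ioc (e : G.E) : Set.InjOn (G.edgePt e) (Set.Ioc 0 (G.len e)) := by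
  intro s hs t ht h
  have h' := congrArg normalForm h
  rw [normalForm_edgePt hs.1.le hs.2, normalForm_edgePt ht.1.le ht.2, if_neg hs.1.ne',
    if_neg ht.1.ne'] at h'
  split_ifs at h' <;> simp_all

theorem edgePt_injOn_Ioo (e : G.E) : Set.InjOn (G.edgePt e) (Set.Ioo 0 (G.len e)) :=
  (edgePt_injOn_Ico e).mono Set.Ioo_subset_Ico_self

theorem edgePt_injOn_Icc {e : G.E} (he : G.src e ≠ G.tgt e) :
    Set.InjOn (G.edgePt e) (Set.Icc 0 (G.len e)) := by
  intro s hs t ht h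
  have h' := congrArg normalForm h
  rw [normalForm_edgePt hs.1 hs.2, normalForm_edgePt ht.1 ht.2] at h'
  split_ifs at h' <;> simp_all

theorem edgePt_interior_inj {e e' : G.E} {t t' : ℝ} (h0 : 0 < t) (h1 : t < G.len e) (h0' : 0 ≤ t')
    (h1' : t' ≤ G.len e') (h : G.edgePt e t = G.edgePt e' t') : e = e' ∧ t = t' := by
  have h' := congrArg normalForm h
  rw [normalForm_edgePt h0.le h1.le, normalForm_edgePt h0' h1', if_neg h0.ne', if_neg h1.ne] at h'
  split_ifs at h'
  simpa using h'

theorem edgePt_ne_vertexPt {e : G.E} {t : ℝ} (h0 : 0 < t) (h1 : t < G.len e) (v : G.V) :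
    G.edgePt e t ≠ G.vertexPt v := fun h => by
  have h' := congrArg normalForm h
  rw [normalForm_edgePt h0.le h1.le, if_neg h0.ne', if_neg h1.ne] at h'
  simp at h'

/-! ### Outgoing directions -/

theorem isDir_true {x : G.Space} {e : G.E} :
    G.IsDir x (e, true) ↔ ∃ t, 0 ≤ t ∧ t < G.len e ∧ x = G.edgePt e t := by
  simp [IsDir]

theorem isDir_false {x : G.Space} {e : G.E} :
    G.IsDir x (e, false) ↔ ∃ t, 0 < t ∧ t ≤ G.len e ∧ x = G.edgePt e t := by
  simp [IsDir]

theorem dirCoord_true {e : G.E} {t : ℝ} (h0 : 0 ≤ t) (h1 : t < G.len e) :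
    G.dirCoord (G.edgePt e t) (e, true) = t := by
  have h : ∃ s, 0 ≤ s ∧ s < G.len e ∧ G.edgePt e t = G.edgePt e s := ⟨t, h0, h1, rfl⟩
  simp only [dirCoord, if_true]
  rw [dif_pos h]
  obtain ⟨h2, h3, h4⟩ := h.choose_spec
  exact (edgePt_injOn_Ico e ⟨h0, h1⟩ ⟨h2, h3⟩ h4).symm

theorem dirCoord_false {e : G.E} {t : ℝ} (h0 : 0 < t) (h1 : t ≤ G.len e) :
    G.dirCoord (G.edgePt e t) (e, false) = t := by
  have h : ∃ s, 0 < s ∧ s ≤ G.len e ∧ G.edgePt e t = G.edgePt e s := ⟨t, h0, h1, rfl⟩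
  simp only [dirCoord, Bool.false_eq_true, if_false]
  rw [dif_pos h]
  obtain ⟨h2, h3, h4⟩ := h.choose_spec
  exact (edgePt_injOn_Ioc e ⟨h0, h1⟩ ⟨h2, h3⟩ h4).symm

theorem dirPt_true {e : G.E} {t : ℝ} (h0 : 0 ≤ t) (h1 : t < G.len e) (u : ℝ) :
    G.dirPt (G.edgePt e t) (e, true) u = G.edgePt e (t + u) := by
  simp [dirPt, dirCoord_true h0 h1]

theorem dirPt_false {e : G.E} {t : ℝ} (h0 : 0 < t) (h1 : t ≤ G.len e) (u : ℝ) :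
    G.dirPt (G.edgePt e t) (e, false) u = G.edgePt e (t - u) := by
  simp [dirPt, dirCoord_false h0 h1, sub_eq_add_neg]

theorem isDir_vertexPt_true {v : G.V} {e : G.E} :
    G.IsDir (G.vertexPt v) (e, true) ↔ G.src e = v := by
  rw [isDir_true]
  constructor
  · rintro ⟨t, h0, h1, h⟩
    rcases h0.eq_or_lt with rfl | h0
    · rw [edgePt_zero] at h
      exact (vertexPt_injective h).symm
    · exact absurd h.symm (edgePt_ne_vertexPt h0 h1 v)
  · rintro rfl
    exact ⟨0, le_rfl, G.len_pos e, (edgePt_zero e).symm⟩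

theorem isDir_vertexPt_false {v : G.V} {e : G.E} :
    G.IsDir (G.vertexPt v) (e, false) ↔ G.tgt e = v := by
  rw [isDir_false]
  constructor
  · rintro ⟨t, h0, h1, h⟩
    rcases h1.eq_or_lt with rfl | h1
    · rw [edgePt_len] at h
      exact (vertexPt_injective h).symm
    · exact absurd h.symm (edgePt_ne_vertexPt h0 h1 v)
  · rintro rfl
    exact ⟨G.len e, G.len_pos e, le_rfl, (edgePt_len e).symm⟩

theorem isDir_edgePt {e : G.E} {t : ℝ} (h0 : 0 < t) (h1 : t < G.len e) (d : G.E × Bool) :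
    G.IsDir (G.edgePt e t) d ↔ d.1 = e := by
  obtain ⟨e', _ | _⟩ := d
  · rw [isDir_false]
    constructor
    · rintro ⟨s, hs0, hs1, h⟩
      exact (edgePt_interior_inj h0 h1 hs0.le hs1 h).1.symm
    · rintro rfl
      exact ⟨t, h0, h1.le, rfl⟩
  · rw [isDir_true]
    constructor
    · rintro ⟨s, hs0, hs1, h⟩
      exact (edgePt_interior_inj h0 h1 hs0 hs1.le h).1.symm
    · rintro rfl
      exact ⟨t, h0.le, h1, rfl⟩

theorem sum_dirSet {M : Type*} [AddCommMonoid M] (x : G.Space) (φ : G.E × Bool → M) :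
    ∑ d ∈ G.dirSet x, φ d = ∑ e : G.E, ((if G.IsDir x (e, true) then φ (e, true) else 0)
      + if G.IsDir x (e, false) then φ (e, false) else 0) := by
  simp [dirSet, Finset.sum_filter, Fintype.sum_prod_type]

theorem IsDir.exists_eq_edgePt {x : G.Space} {d : G.E × Bool} (hd : G.IsDir x d) :
    (∃ e t, 0 ≤ t ∧ t < G.len e ∧ x = G.edgePt e t ∧ d = (e, true)) ∨
      ∃ e t, 0 < t ∧ t ≤ G.len e ∧ x = G.edgePt e t ∧ d = (e, false) := by
  obtain ⟨e, _ | _⟩ := d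
  · obtain ⟨t, h0, h1, h⟩ := isDir_false.mp hd
    exact Or.inr ⟨e, t, h0, h1, h, rfl⟩
  · obtain ⟨t, h0, h1, h⟩ := isDir_true.mp hd
    exact Or.inl ⟨e, t, h0, h1, h, rfl⟩

/-! ### Functions with integral outgoing slopes -/

/-- The real function `F` is affine along every outgoing direction `d` at every point `x`, with
integral slope `σ x d`. -/
def HasSlopes (F : G.Space → ℝ) (σ : G.Space → G.E × Bool → ℤ) : Prop :=
  ∀ x d, G.IsDir x d → ∃ ε > (0 : ℝ), ∀ u, 0 ≤ u → u ≤ ε → F (G.dirPt x d u) = F x + σ x d * u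

theorem hasSlopes_iff {F : G.Space → ℝ} {σ : G.Space → G.E × Bool → ℤ} :
    HasSlopes F σ ↔ ∀ e, HasOneSidedSlopes (fun t => F (G.edgePt e t)) (G.len e)
      (fun t => σ (G.edgePt e t) (e, true)) (fun t => σ (G.edgePt e t) (e, false)) := by
  constructor
  · refine fun h e => ⟨fun t h0 h1 => ?_, fun t h0 h1 => ?_⟩
    · simpa only [dirPt_true h0 h1] using h _ _ (isDir_true.mpr ⟨t, h0, h1, rfl⟩)
    · simpa only [dirPt_false h0 h1] using h _ _ (isDir_false.mpr ⟨t, h0, h1, rfl⟩)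
  · intro h x d hd
    rcases IsDir.exists_eq_edgePt hd with ⟨e, t, h0, h1, rfl, rfl⟩ | ⟨e, t, h0, h1, rfl, rfl⟩
    · simpa only [dirPt_true h0 h1] using (h e).right t h0 h1
    · simpa only [dirPt_false h0 h1] using (h e).left t h0 h1

namespace HasSlopes

variable {F F' : G.Space → ℝ} {σ σ' : G.Space → G.E × Bool → ℤ}

theorem zero : HasSlopes (0 : G.Space → ℝ) 0 := fun x d _ => ⟨1, one_pos, fun u _ _ => by simp⟩

theorem add (h : HasSlopes F σ) (h' : HasSlopes F' σ') : HasSlopes (F + F') (σ + σ') := by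
  intro x d hd
  obtain ⟨ε, hε, H⟩ := h x d hd
  obtain ⟨ε', hε', H'⟩ := h' x d hd
  refine ⟨min ε ε', lt_min hε hε', fun u h0 h1 => ?_⟩
  simp only [Pi.add_apply, H u h0 (h1.trans (min_le_left _ _)),
    H' u h0 (h1.trans (min_le_right _ _))]
  push_cast
  ring

theorem neg (h : HasSlopes F σ) : HasSlopes (-F) (-σ) := by
  intro x d hd
  obtain ⟨ε, hε, H⟩ := h x d hd
  refine ⟨ε, hε, fun u h0 h1 => ?_⟩
  simp only [Pi.neg_apply, H u h0 h1]
  push_cast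
  ring

theorem eventually_right (h : HasSlopes F σ) {e : G.E} {t : ℝ} (h0 : 0 ≤ t) (h1 : t < G.len e) :
    (fun u => F (G.edgePt e u)) =ᶠ[nhdsWithin t (Set.Ici t)]
      fun u => F (G.edgePt e t) + σ (G.edgePt e t) (e, true) * (u - t) := by
  obtain ⟨ε, hε, H⟩ := (hasSlopes_iff.mp h e).right t h0 h1
  filter_upwards [Icc_mem_nhdsGE (lt_add_of_pos_right t hε)] with u hu
  have := H (u - t) (by linarith [hu.1]) (by linarith [hu.2])
  rwa [add_sub_cancel] at this

theorem eventually_left (h : HasSlopes F σ) {e : G.E} {t : ℝ} (h0 : 0 < t) (h1 : t ≤ G.len e) :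
    (fun u => F (G.edgePt e u)) =ᶠ[nhdsWithin t (Set.Iic t)]
      fun u => F (G.edgePt e t) + σ (G.edgePt e t) (e, false) * (t - u) := by
  obtain ⟨ε, hε, H⟩ := (hasSlopes_iff.mp h e).left t h0 h1
  filter_upwards [Icc_mem_nhdsLE (sub_lt_self t hε)] with u hu
  have := H (t - u) (by linarith [hu.2]) (by linarith [hu.1])
  rwa [sub_sub_cancel] at this

theorem continuous_edge (h : HasSlopes F σ) (e : G.E) : Continuous fun t => F (G.edgePt e t) := by
  refine continuous_iff_continuousAt.mpr fun t => continuousAt_iff_continuous_left_right.mpr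
    ⟨?_, ?_⟩
  · rcases le_or_gt t 0 with ht | ht
    · refine (continuousWithinAt_const (b := F (G.edgePt e 0))).congr (fun u hu => ?_) ?_
      · rw [edgePt_of_nonpos (le_trans hu ht)]
      · rw [edgePt_of_nonpos ht]
    rcases le_or_gt t (G.len e) with ht' | ht'
    · refine ContinuousWithinAt.congr_of_eventuallyEq ?_ (h.eventually_left ht ht') (by simp)
      fun_prop
    · refine (continuousWithinAt_const (b := F (G.edgePt e (G.len e)))).congr_of_eventuallyEq ?_ ?_
      · filter_upwards [mem_nhdsWithin_of_mem_nhds (Ioi_mem_nhds ht')] with u hu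
        rw [edgePt_of_len_le (le_of_lt hu)]
      · rw [edgePt_of_len_le ht'.le]
  · rcases le_or_gt (G.len e) t with ht | ht
    · refine (continuousWithinAt_const (b := F (G.edgePt e (G.len e)))).congr (fun u hu => ?_) ?_
      · rw [edgePt_of_len_le (le_trans ht hu)]
      · rw [edgePt_of_len_le ht]
    rcases le_or_gt 0 t with ht' | ht'
    · refine ContinuousWithinAt.congr_of_eventuallyEq ?_ (h.eventually_right ht' ht) (by simp)
      fun_prop
    · refine (continuousWithinAt_const (b := F (G.edgePt e 0))).congr_of_eventuallyEq ?_ ?_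
      · filter_upwards [mem_nhdsWithin_of_mem_nhds (Iio_mem_nhds ht')] with u hu
        rw [edgePt_of_nonpos (le_of_lt hu)]
      · rw [edgePt_of_nonpos ht'.le]

protected theorem continuous (h : HasSlopes F σ) : Continuous F := by
  refine continuous_coinduced_dom.mpr ?_
  have hE : Continuous fun p : G.E × ℝ => F (G.edgePt p.1 p.2) := by
    have : DiscreteTopology G.E := ⟨rfl⟩
    exact continuous_prod_of_discrete_left.mpr h.continuous_edge
  have hV : Continuous fun v : G.V => F (G.vertexPt v) := by
    have : DiscreteTopology G.V := ⟨rfl⟩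
    exact continuous_of_discreteTopology
  have hS : Continuous (Sum.elim (fun v : G.V => F (G.vertexPt v))
      fun p : G.E × ℝ => F (G.edgePt p.1 p.2)) := hV.sumElim hE
  refine (hS.comp (continuous_subtype_val (p := G.Ok))).congr ?_
  rintro ⟨v | ⟨e, t⟩, hx⟩
  · rfl
  · exact congrArg F (edgePt_eq_mk hx.1 hx.2)

/-- The rational function underlying a function with integral slopes. -/
def toRatFn (h : HasSlopes F σ) : RatFn G where
  toFun := F
  continuous := h.continuous
  piecewise e := (hasSlopes_iff.mp h e).pwIntAffine (G.len_pos e).le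

theorem rightSlope_eq {f : RatFn G} (h : HasSlopes f.toFun σ) {e : G.E} {t : ℝ} (h0 : 0 ≤ t)
    (h1 : t < G.len e) : G.rightSlope f e t = σ (G.edgePt e t) (e, true) := by
  have hd : HasDerivWithinAt
      (fun u => f.toFun (G.edgePt e t) + (σ (G.edgePt e t) (e, true) : ℝ) * (u - t))
      (σ (G.edgePt e t) (e, true)) (Set.Ici t) t := by
    simpa using (((hasDerivWithinAt_id t (Set.Ici t)).sub_const t).const_mul
      (σ (G.edgePt e t) (e, true) : ℝ)).const_add (f.toFun (G.edgePt e t))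
  exact (hd.congr_of_eventuallyEq (h.eventually_right h0 h1) (by simp)).derivWithin
    (uniqueDiffWithinAt_Ici t)

theorem leftSlope_eq {f : RatFn G} (h : HasSlopes f.toFun σ) {e : G.E} {t : ℝ} (h0 : 0 < t)
    (h1 : t ≤ G.len e) : G.leftSlope f e t = -σ (G.edgePt e t) (e, false) := by
  have hd : HasDerivWithinAt
      (fun u => f.toFun (G.edgePt e t) + (σ (G.edgePt e t) (e, false) : ℝ) * (t - u))
      (-σ (G.edgePt e t) (e, false)) (Set.Iic t) t := by
    simpa using (((hasDerivWithinAt_id t (Set.Iic t)).const_sub t).const_mul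
      (σ (G.edgePt e t) (e, false) : ℝ)).const_add (f.toFun (G.edgePt e t))
  exact (hd.congr_of_eventuallyEq (h.eventually_left h0 h1) (by simp)).derivWithin
    (uniqueDiffWithinAt_Iic t)

/-- The order of a rational function at a point is the sum of its outgoing slopes. -/
theorem ordAt_eq {f : RatFn G} (h : HasSlopes f.toFun σ) (x : G.Space) :
    G.ordAt f x = ∑ d ∈ G.dirSet x, (σ x d : ℝ) := by
  unfold ordAt
  split_ifs with hv hi
  · obtain ⟨v, hvx⟩ : ∃ v, v = hv.choose := ⟨_, rfl⟩
    have hx := hv.choose_spec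
    rw [← hvx] at hx ⊢
    clear hvx hv
    subst hx
    rw [sum_dirSet]
    refine Finset.sum_congr rfl fun e _ => ?_
    simp only [isDir_vertexPt_true, isDir_vertexPt_false]
    congr 1 <;> refine if_ctx_congr Iff.rfl (fun hs => ?_) fun _ => rfl
    · rw [h.rightSlope_eq le_rfl (G.len_pos e), edgePt_zero, hs]
    · rw [h.leftSlope_eq (G.len_pos e) le_rfl, edgePt_len, hs, neg_neg]
  · obtain ⟨p, hp⟩ : ∃ p, p = hi.choose := ⟨_, rfl⟩
    obtain ⟨h0, h1, hx⟩ := hi.choose_spec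
    rw [← hp] at h0 h1 hx ⊢
    clear hp hi
    subst hx
    rw [sum_dirSet, Finset.sum_eq_single p.1]
    · simp [isDir_edgePt h0 h1, h.rightSlope_eq h0.le h1, h.leftSlope_eq h0 h1.le]
    · intro e _ he
      simp [isDir_edgePt h0 h1, he]
    · simp
  · rcases eq_vertexPt_or_eq_edgePt x with hx | ⟨e, t, h0, h1, hx⟩
    · exact absurd hx hv
    · exact (hi ⟨(e, t), h0, h1, hx⟩).elim

/-- The divisor of a function with integral slopes has degree zero. -/
theorem degDiv_eq_zero (h : HasSlopes F σ) {D : G.Div} (hD : ∀ x, D x = ∑ d ∈ G.dirSet x, σ x d) :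
    G.degDiv D = 0 := by
  set S : Finset G.Space := D.support ∪ Finset.univ.image G.vertexPt with hS
  have hvS : ∀ v, G.vertexPt v ∈ S := fun v => by simp [hS]
  have hsum : G.degDiv D = ∑ x ∈ S, D x :=
    Finset.sum_subset Finset.subset_union_left fun x _ hx => Finsupp.notMem_support_iff.mp hx
  rw [hsum, Finset.sum_congr rfl fun x _ => (hD x).trans (sum_dirSet x (σ x)), Finset.sum_comm]
  refine Finset.sum_eq_zero fun e _ => ?_
  have hfin : {t : ℝ | (0 < t ∧ t < G.len e) ∧ G.edgePt e t ∈ S}.Finite := by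
    refine Set.Finite.of_finite_image (f := G.edgePt e) (S.finite_toSet.subset ?_) ?_
    · rintro _ ⟨t, ht, rfl⟩
      exact ht.2
    · exact (edgePt_injOn_Ioo e).mono fun t ht => ht.1
  set T : Finset ℝ := hfin.toFinset with hT
  have memT : ∀ t, t ∈ T ↔ (0 < t ∧ t < G.len e) ∧ G.edgePt e t ∈ S := fun t => by simp [hT]
  have hL := G.len_pos e
  have h0T : (0 : ℝ) ∉ T := fun h' => absurd ((memT 0).mp h').1.1 (lt_irrefl _)
  have hLT : G.len e ∉ T := fun h' => absurd ((memT _).mp h').1.2 (lt_irrefl _)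
  have hright : S.filter (fun x => G.IsDir x (e, true)) = (insert 0 T).image (G.edgePt e) := by
    ext x
    simp only [Finset.mem_filter, isDir_true, Finset.mem_image, Finset.mem_insert, memT]
    constructor
    · rintro ⟨hx, t, h0, h1, rfl⟩
      refine ⟨t, ?_, rfl⟩
      rcases h0.eq_or_lt with rfl | h0
      · exact Or.inl rfl
      · exact Or.inr ⟨⟨h0, h1⟩, hx⟩
    · rintro ⟨t, rfl | ⟨⟨h0, h1⟩, hx⟩, rfl⟩
      · exact ⟨edgePt_zero e ▸ hvS _, 0, le_rfl, hL, rfl⟩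
      · exact ⟨hx, t, h0.le, h1, rfl⟩
  have hleft : S.filter (fun x => G.IsDir x (e, false))
      = (insert (G.len e) T).image (G.edgePt e) := by
    ext x
    simp only [Finset.mem_filter, isDir_false, Finset.mem_image, Finset.mem_insert, memT]
    constructor
    · rintro ⟨hx, t, h0, h1, rfl⟩
      refine ⟨t, ?_, rfl⟩
      rcases h1.eq_or_lt with rfl | h1
      · exact Or.inl rfl
      · exact Or.inr ⟨⟨h0, h1⟩, hx⟩
    · rintro ⟨t, rfl | ⟨⟨h0, h1⟩, hx⟩, rfl⟩
      · exact ⟨edgePt_len e ▸ hvS _, _, hL, le_rfl, rfl⟩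
      · exact ⟨hx, t, h0, h1.le, rfl⟩
  rw [Finset.sum_add_distrib, ← Finset.sum_filter, ← Finset.sum_filter, hright, hleft,
    Finset.sum_image, Finset.sum_image, Finset.sum_insert h0T, Finset.sum_insert hLT]
  · have key := (hasSlopes_iff.mp h e).sum_slopes_eq_zero hL (T := T) (fun t ht => ((memT t).mp ht).1)
      fun t h0 h1 ht => by
        have hx : G.edgePt e t ∉ S := fun hx => ht ((memT t).mpr ⟨⟨h0, h1⟩, hx⟩)
        have hDx : D (G.edgePt e t) = 0 :=
          Finsupp.notMem_support_iff.mp fun h' => hx (Finset.mem_union_left _ h')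
        rw [hD, sum_dirSet, Finset.sum_eq_single e] at hDx
        · simpa [isDir_edgePt h0 h1] using hDx
        · intro e' _ he
          simp [isDir_edgePt h0 h1, he]
        · simp
    rw [Finset.sum_add_distrib] at key
    linarith
  · refine (edgePt_injOn_Ioc e).mono fun t ht => ?_
    rcases Finset.mem_insert.mp ht with rfl | ht
    · exact ⟨hL, le_rfl⟩
    · exact ⟨((memT t).mp ht).1.1, ((memT t).mp ht).1.2.le⟩
  · refine (edgePt_injOn_Ico e).mono fun t ht => ?_
    rcases Finset.mem_insert.mp ht with rfl | ht
    · exact ⟨le_rfl, hL⟩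
    · exact ⟨((memT t).mp ht).1.1.le, ((memT t).mp ht).1.2⟩

end HasSlopes

theorem exists_hasSlopes (f : RatFn G) : ∃ σ, HasSlopes f.toFun σ := by
  choose p q h using fun e => (f.piecewise e).exists_hasOneSidedSlopes
  refine ⟨fun x d => if d.2 then p d.1 (G.dirCoord x d) else q d.1 (G.dirCoord x d),
    hasSlopes_iff.mpr fun e => ⟨fun t h0 h1 => ?_, fun t h0 h1 => ?_⟩⟩
  · simpa [dirCoord_true h0 h1] using (h e).right t h0 h1
  · simpa [dirCoord_false h0 h1] using (h e).left t h0 h1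

theorem degDiv_eq_zero_of_isPrincipal {D : G.Div} {f : RatFn G} (h : G.IsPrincipal D f) :
    G.degDiv D = 0 := by
  obtain ⟨σ, hσ⟩ := exists_hasSlopes f
  refine hσ.degDiv_eq_zero fun x => ?_
  have := h x
  rw [hσ.ordAt_eq] at this
  exact_mod_cast this

theorem degDiv_sub (D D' : G.Div) : G.degDiv (D - D') = G.degDiv D - G.degDiv D' :=
  Finsupp.sum_sub_index fun _ _ _ => rfl

theorem degDiv_single (x : G.Space) (n : ℤ) : G.degDiv (Finsupp.single x n) = n :=
  Finsupp.sum_single_index rfl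

theorem Effective.degDiv_nonneg {D : G.Div} (h : G.Effective D) : 0 ≤ G.degDiv D :=
  Finset.sum_nonneg fun x _ => h x

theorem Effective.eq_single {E : G.Div} (h : G.Effective E) (h1 : G.degDiv E = 1) :
    ∃ y, E = Finsupp.single y 1 := by
  obtain ⟨y, hy⟩ : ∃ y, E y ≠ 0 := by
    by_contra! h'
    have : E = 0 := Finsupp.ext h'
    simp [this, degDiv] at h1
  have hy1 : 1 ≤ E y := Int.add_one_le_iff.mpr (lt_of_le_of_ne (h y) (Ne.symm hy))
  have heff : G.Effective (E - Finsupp.single y 1) := fun x => by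
    by_cases hx : y = x
    · subst hx; simpa using hy1
    · simpa [Finsupp.single_apply, hx] using h x
  have hdeg : G.degDiv (E - Finsupp.single y 1) = 0 := by rw [degDiv_sub, degDiv_single, h1, sub_self]
  refine ⟨y, sub_eq_zero.mp (Finsupp.ext fun x => ?_)⟩
  by_contra hx
  exact hx ((Finset.sum_eq_zero_iff_of_nonneg fun z _ => heff z).mp hdeg x
    (Finsupp.mem_support_iff.mpr hx))

/-- An effective divisor of which every point can be moved into the support has rank at
least one. -/
theorem one_le_rk [Nonempty G.Space] {D : G.Div} (hD : G.Effective D)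
    (h : ∀ y, ∃ E' : G.Div, G.Effective E' ∧ G.LinEquiv (D - Finsupp.single y 1) E') :
    1 ≤ G.Rk D := by
  refine le_csSup ⟨G.degDiv D, fun k hk => ?_⟩ fun E hE hdeg => ?_
  · by_contra! hlt
    have hk0 : 0 ≤ k := hD.degDiv_nonneg.trans hlt.le
    obtain ⟨E', hE', f, hf⟩ := hk (Finsupp.single (Classical.arbitrary _) k)
      (fun x => by rw [Finsupp.single_apply]; split_ifs <;> simp [hk0]) (degDiv_single _ _)
    have := degDiv_eq_zero_of_isPrincipal hf
    rw [degDiv_sub, degDiv_sub, degDiv_single] at this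
    linarith [hE'.degDiv_nonneg]
  · obtain ⟨y, rfl⟩ := hE.eq_single hdeg
    exact h y

/-! ### Point divisors on metric trees -/

/-- The function on the realization with prescribed values on vertices and edges. -/
def glue (c : G.V → ℝ) (g : G.E → ℝ → ℝ) (h0 : ∀ e, g e 0 = c (G.src e))
    (h1 : ∀ e, g e (G.len e) = c (G.tgt e)) : G.Space → ℝ :=
  Quot.lift (fun x => Sum.elim c (fun p => g p.1 p.2) x.1) (by
    rintro _ _ (e | e)
    · exact (h0 e).symm
    · exact (h1 e).symm)

theorem glue_edgePt {c : G.V → ℝ} {g : G.E → ℝ → ℝ} {h0 : ∀ e, g e 0 = c (G.src e)}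
    {h1 : ∀ e, g e (G.len e) = c (G.tgt e)} {e : G.E} {t : ℝ} (ht0 : 0 ≤ t) (ht1 : t ≤ G.len e) :
    glue c g h0 h1 (G.edgePt e t) = g e t := by
  rw [edgePt_eq_mk ht0 ht1]
  rfl

/-- On a connected graph, a function on vertices which is constant along edges is constant. -/
theorem eq_of_forall_src_eq_tgt [ConnectedSpace G.Space] {c : G.V → ℝ}
    (hc : ∀ e, c (G.src e) = c (G.tgt e)) (v w : G.V) : c v = c w := by
  set F : G.Space → ℝ := glue c (fun e _ => c (G.src e)) (fun _ => rfl) hc with hF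
  have hs : HasSlopes F 0 := hasSlopes_iff.mpr fun e => by
    have hconst : ∀ t, F (G.edgePt e t) = c (G.src e) := fun t => by
      rw [← edgePt_clamp]
      exact glue_edgePt (le_max_left 0 _) (max_le (G.len_pos e).le (min_le_right _ _))
    constructor <;> exact fun t _ _ => ⟨1, one_pos, fun u _ _ => by simp [hconst]⟩
  have hfin : (Set.range F).Finite := (Set.finite_range c).subset (by
    rintro _ ⟨x, rfl⟩
    rcases eq_vertexPt_or_eq_edgePt x with ⟨v, rfl⟩ | ⟨e, t, h0, h1, rfl⟩
    · exact ⟨v, rfl⟩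
    · exact ⟨G.src e, by rw [hF, glue_edgePt h0.le h1.le]⟩)
  exact Set.not_nontrivial_iff.mp
    (fun h => (isPreconnected_range hs.continuous).infinite_of_nontrivial h hfin)
    ⟨G.vertexPt v, rfl⟩ ⟨G.vertexPt w, rfl⟩

/-- Every edge of a tree is a bridge: there is a function on vertices jumping by one along a
given edge and constant along all other edges. -/
theorem exists_bridge_function [ConnectedSpace G.Space] (hG : G.genus = 0) (e : G.E) :
    ∃ c : G.V → ℝ, ∀ e', c (G.tgt e') - c (G.src e') = if e' = e then 1 else 0 := by
  set δ : (G.V → ℝ) →ₗ[ℝ] (G.E → ℝ) :=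
    LinearMap.funLeft ℝ ℝ G.tgt - LinearMap.funLeft ℝ ℝ G.src with hδ
  have hδ' : ∀ c e', δ c e' = c (G.tgt e') - c (G.src e') := fun c e' => rfl
  have hker : Module.finrank ℝ (LinearMap.ker δ) ≤ 1 := by
    have hle : LinearMap.ker δ ≤ Submodule.span ℝ {(fun _ => 1 : G.V → ℝ)} := fun c hc => by
      rw [Submodule.mem_span_singleton]
      have hc' : ∀ e', c (G.src e') = c (G.tgt e') := fun e' =>
        (sub_eq_zero.mp ((hδ' c e').symm.trans (congrFun (LinearMap.mem_ker.mp hc) e'))).symm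
      exact ⟨c (G.src e), funext fun v => by simp [eq_of_forall_src_eq_tgt hc' v (G.src e)]⟩
    exact (Submodule.finrank_mono hle).trans ((finrank_span_le_card _).trans (by simp))
  have hrank := δ.finrank_range_add_finrank_ker
  have hle := Submodule.finrank_le (LinearMap.range δ)
  rw [Module.finrank_fintype_fun_eq_card] at hrank hle
  have hcard : Fintype.card G.V = Fintype.card G.E + 1 := by
    unfold genus at hG
    omega
  have htop : LinearMap.range δ = ⊤ := Submodule.eq_top_of_finrank_eq (by
    rw [Module.finrank_fintype_fun_eq_card]
    omega)
  obtain ⟨c, hc⟩ := LinearMap.range_eq_top.mp htop (fun e' => if e' = e then 1 else 0)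
  exact ⟨c, fun e' => (hδ' c e').symm.trans (congrFun hc e')⟩

/-- There is a function with integral slopes and divisor `[x] - [z]`. -/
def PtEquiv (x z : G.Space) : Prop :=
  ∃ F σ, HasSlopes F σ ∧ ∀ y : G.Space,
    ∑ d ∈ G.dirSet y, σ y d = (if y = x then 1 else 0) - if y = z then 1 else 0

namespace PtEquiv

theorem refl (x : G.Space) : PtEquiv x x := ⟨0, 0, HasSlopes.zero, fun y => by simp⟩

theorem symm {x z : G.Space} : PtEquiv x z → PtEquiv z x := by
  rintro ⟨F, σ, h, hσ⟩
  exact ⟨-F, -σ, h.neg, fun y => by simp [hσ]⟩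

theorem trans {x y z : G.Space} : PtEquiv x y → PtEquiv y z → PtEquiv x z := by
  rintro ⟨F, σ, h, hσ⟩ ⟨F', σ', h', hσ'⟩
  exact ⟨F + F', σ + σ', h.add h', fun w => by simp [Finset.sum_add_distrib, hσ, hσ']⟩

end PtEquiv

/-- On a tree, all points of an edge are equivalent to its source. -/
theorem ptEquiv_edgePt [ConnectedSpace G.Space] (hG : G.genus = 0) {e : G.E} {T : ℝ} (hT0 : 0 < T)
    (hT1 : T ≤ G.len e) : PtEquiv (G.edgePt e 0) (G.edgePt e T) := by
  obtain ⟨c, hc⟩ := exists_bridge_function hG e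
  have hne : G.src e ≠ G.tgt e := fun h => by simpa [h] using hc e
  set F : G.Space → ℝ := glue (fun v => T * c v)
    (fun e' t => T * c (G.src e') + if e' = e then min t T else 0)
    (fun e' => by simp [hT0.le])
    (fun e' => by
      have := hc e'
      by_cases h : e' = e
      · subst h
        rw [if_pos rfl] at this ⊢
        rw [min_eq_right hT1, sub_eq_iff_eq_add'.mp this]
        ring
      · rw [if_neg h] at this ⊢
        rw [sub_eq_zero.mp this, add_zero]) with hF
  have hFe : ∀ {e' t}, 0 ≤ t → t ≤ G.len e' →
      F (G.edgePt e' t) = T * c (G.src e') + if e' = e then min t T else 0 :=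
    fun h0 h1 => glue_edgePt h0 h1
  refine ⟨F, fun y d => if d.1 = e then
      if d.2 then (if G.dirCoord y d < T then 1 else 0)
      else (if G.dirCoord y d ≤ T then -1 else 0)
    else 0, hasSlopes_iff.mpr fun e' => ⟨fun t h0 h1 => ?_, fun t h0 h1 => ?_⟩, fun y => ?_⟩
  · simp only [dirCoord_true h0 h1, if_true]
    by_cases he : e' = e
    · subst he
      by_cases ht : t < T
      · refine ⟨T - t, sub_pos.mpr ht, fun u hu0 hu1 => ?_⟩
        rw [hFe h0 h1.le, hFe (by linarith) (by linarith)]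
        simp only [if_true, ht]
        rw [min_eq_left ht.le, min_eq_left (by linarith)]
        push_cast
        ring
      · refine ⟨G.len e' - t, sub_pos.mpr h1, fun u hu0 hu1 => ?_⟩
        rw [hFe h0 h1.le, hFe (by linarith) (by linarith)]
        simp only [if_true, ht, if_false]
        rw [min_eq_right (not_lt.mp ht), min_eq_right (by linarith)]
        push_cast
        ring
    · refine ⟨G.len e' - t, sub_pos.mpr h1, fun u hu0 hu1 => ?_⟩
      rw [hFe h0 h1.le, hFe (by linarith) (by linarith)]
      simp [he]
  · simp only [dirCoord_false h0 h1, Bool.false_eq_true, if_false]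
    by_cases he : e' = e
    · subst he
      by_cases ht : t ≤ T
      · refine ⟨t, h0, fun u hu0 hu1 => ?_⟩
        rw [hFe h0.le h1, hFe (by linarith) (by linarith)]
        simp only [if_true, ht]
        rw [min_eq_left ht, min_eq_left (by linarith)]
        push_cast
        ring
      · refine ⟨t - T, sub_pos.mpr (not_le.mp ht), fun u hu0 hu1 => ?_⟩
        rw [hFe h0.le h1, hFe (by linarith) (by linarith)]
        simp only [if_true, ht, if_false]
        rw [min_eq_right (not_le.mp ht).le, min_eq_right (by linarith)]
        push_cast
        ring
    · refine ⟨t, h0, fun u hu0 hu1 => ?_⟩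
      rw [hFe h0.le h1, hFe (by linarith) (by linarith)]
      simp [he]
  · rw [sum_dirSet, Finset.sum_eq_single e (fun e' _ he => by simp [he]) (by simp)]
    simp only [if_true, Bool.false_eq_true, if_false]
    by_cases hy : ∃ s, 0 ≤ s ∧ s ≤ G.len e ∧ y = G.edgePt e s
    · obtain ⟨s, hs0, hs1, rfl⟩ := hy
      have hinj : ∀ {r}, 0 ≤ r → r ≤ G.len e → (G.edgePt e s = G.edgePt e r ↔ s = r) :=
        fun hr0 hr1 => (edgePt_injOn_Icc hne).eq_iff ⟨hs0, hs1⟩ ⟨hr0, hr1⟩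
      rw [hinj le_rfl (hT0.le.trans hT1), hinj hT0.le hT1]
      rcases hs0.eq_or_lt with rfl | hs0'
      · have hf : ¬ G.IsDir (G.edgePt e 0) (e, false) := fun h => by
          obtain ⟨r, hr0, hr1, h⟩ := isDir_false.mp h
          exact hr0.ne ((hinj hr0.le hr1).mp h)
        rw [if_pos (isDir_true.mpr ⟨0, le_rfl, hT0.trans_le hT1, rfl⟩), if_neg hf,
          dirCoord_true le_rfl (hT0.trans_le hT1)]
        simp [hT0, hT0.ne]
      · rw [if_pos (isDir_false.mpr ⟨s, hs0', hs1, rfl⟩), dirCoord_false hs0' hs1]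
        rcases hs1.eq_or_lt with rfl | hs1'
        · have hf : ¬ G.IsDir (G.edgePt e (G.len e)) (e, true) := fun h => by
            obtain ⟨r, hr0, hr1, h⟩ := isDir_true.mp h
            exact hr1.ne' ((hinj hr0 hr1.le).mp h)
          rw [if_neg hf]
          split_ifs <;> first | rfl | (exfalso; grind)
        · rw [if_pos (isDir_true.mpr ⟨s, hs0, hs1', rfl⟩), dirCoord_true hs0 hs1']
          split_ifs <;> first | rfl | (exfalso; grind)
    · have hne' : ∀ {r}, 0 ≤ r → r ≤ G.len e → y ≠ G.edgePt e r :=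
        fun hr0 hr1 h => hy ⟨_, hr0, hr1, h⟩
      rw [if_neg fun h => ?_, if_neg fun h => ?_, if_neg (hne' le_rfl (hT0.le.trans hT1)),
        if_neg (hne' hT0.le hT1)]
      · rfl
      · obtain ⟨r, hr0, hr1, h⟩ := isDir_false.mp h
        exact hne' hr0.le hr1 h
      · obtain ⟨r, hr0, hr1, h⟩ := isDir_true.mp h
        exact hne' hr0 hr1.le h

/-- On a tree, any two points are equivalent. -/
theorem ptEquiv_of_genus_eq_zero [ConnectedSpace G.Space] (hG : G.genus = 0) (x z : G.Space) :
    PtEquiv x z := by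
  have hvert : ∀ v w, PtEquiv (G.vertexPt v) (G.vertexPt w) := fun v w => by
    have h := eq_of_forall_src_eq_tgt
      (c := fun w => if PtEquiv (G.vertexPt v) (G.vertexPt w) then 1 else 0) (fun e => by
        have he := ptEquiv_edgePt hG (G.len_pos e) le_rfl
        rw [edgePt_zero, edgePt_len] at he
        exact if_congr ⟨fun h => h.trans he, fun h => h.trans he.symm⟩ rfl rfl) w v
    simp only [PtEquiv.refl, if_true] at h
    by_contra hw
    simp [hw] at h
  have hpt : ∀ y, ∃ v, PtEquiv y (G.vertexPt v) := fun y => by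
    rcases eq_vertexPt_or_eq_edgePt y with ⟨v, rfl⟩ | ⟨e, t, h0, h1, rfl⟩
    · exact ⟨v, .refl _⟩
    · exact ⟨G.src e, edgePt_zero e ▸ (ptEquiv_edgePt hG h0 h1.le).symm⟩
  obtain ⟨v, hv⟩ := hpt x
  obtain ⟨w, hw⟩ := hpt z
  exact hv.trans ((hvert v w).trans hw.symm)

/-- An outgoing direction contains infinitely many points near its origin. -/
theorem infinite_image_dirPt {x : G.Space} {d : G.E × Bool} (hd : G.IsDir x d) {ε : ℝ}
    (hε : 0 < ε) : (G.dirPt x d '' Set.Icc 0 ε).Infinite := by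
  rcases IsDir.exists_eq_edgePt hd with ⟨e, t, h0, h1, rfl, rfl⟩ | ⟨e, t, h0, h1, rfl, rfl⟩
  · have hpos : 0 < min ε (G.len e - t) := lt_min hε (sub_pos.mpr h1)
    refine Set.Infinite.mono (Set.image_mono (s := Set.Ioo 0 (min ε (G.len e - t)))
      fun u hu => ⟨hu.1.le, hu.2.le.trans (min_le_left _ _)⟩) ?_
    refine (Set.Ioo_infinite hpos).image fun u hu v hv h => ?_
    rw [dirPt_true h0 h1, dirPt_true h0 h1] at h
    have := edgePt_injOn_Ioo e
      ⟨by linarith [hu.1], by linarith [hu.2, min_le_right ε (G.len e - t)]⟩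
      ⟨by linarith [hv.1], by linarith [hv.2, min_le_right ε (G.len e - t)]⟩ h
    linarith
  · have hpos : 0 < min ε t := lt_min hε h0
    refine Set.Infinite.mono (Set.image_mono (s := Set.Ioo 0 (min ε t))
      fun u hu => ⟨hu.1.le, hu.2.le.trans (min_le_left _ _)⟩) ?_
    refine (Set.Ioo_infinite hpos).image fun u hu v hv h => ?_
    rw [dirPt_false h0 h1, dirPt_false h0 h1] at h
    have := edgePt_injOn_Ioo e
      ⟨by linarith [hu.2, min_le_right ε t], by linarith [hu.1]⟩
      ⟨by linarith [hv.2, min_le_right ε t], by linarith [hv.1]⟩ h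
    linarith

end CombGraph

/-! ### Pulling back along covers -/

namespace TropCover

open CombGraph

variable {G D : CombGraph} (π : TropCover G D)

theorem slope_pos {x : G.Space} {d : G.E × Bool} (hd : G.IsDir x d) : 0 < π.slope x d := by
  refine Nat.pos_of_ne_zero fun h0 => ?_
  obtain ⟨ε, hε, H⟩ := π.locAffine x d hd
  refine infinite_image_dirPt hd hε
    ((π.finiteFibers (D.dirPt (π.toFun x) (π.dirMap x d) 0)).subset ?_)
  rintro _ ⟨u, hu, rfl⟩
  simpa [h0] using H u hu.1 hu.2

theorem localDeg_pos (x : G.Space) : 0 < π.localDeg x := by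
  by_cases h : ∃ d, G.IsDir x d
  · obtain ⟨d, hd⟩ := h
    rw [π.localDeg_spec x _ (π.dirMap_isDir x d hd)]
    exact Finset.sum_pos' (fun _ _ => Nat.zero_le _)
      ⟨d, by simp [dirSet, hd], π.slope_pos hd⟩
  · have hval : G.valence x = 0 := by
      push Not at h
      simp [valence, dirSet, h]
    have := π.rh_nonneg x
    refine Nat.pos_of_ne_zero fun h0 => ?_
    simp [hval, h0] at this

theorem hasSlopes_comp {F : D.Space → ℝ} {σ : D.Space → D.E × Bool → ℤ} (h : HasSlopes F σ) :
    HasSlopes (F ∘ π.toFun) fun x d => π.slope x d * σ (π.toFun x) (π.dirMap x d) := by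
  intro x d hd
  obtain ⟨ε, hε, H⟩ := π.locAffine x d hd
  obtain ⟨ε', hε', H'⟩ := h _ _ (π.dirMap_isDir x d hd)
  have hs : (0 : ℝ) < π.slope x d := by exact_mod_cast π.slope_pos hd
  refine ⟨min ε (ε' / π.slope x d), lt_min hε (div_pos hε' hs), fun u h0 h1 => ?_⟩
  have hu := (le_div_iff₀' hs).mp (h1.trans (min_le_right _ _))
  simp only [Function.comp_apply, H u h0 (h1.trans (min_le_left _ _)),
    H' _ (mul_nonneg hs.le h0) hu]
  push_cast
  ring

theorem sum_slopes_comp (σ : D.Space → D.E × Bool → ℤ) (x : G.Space) :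
    ∑ d ∈ G.dirSet x, (π.slope x d : ℤ) * σ (π.toFun x) (π.dirMap x d)
      = π.localDeg x * ∑ d' ∈ D.dirSet (π.toFun x), σ (π.toFun x) d' := by
  have hmaps : ∀ d ∈ G.dirSet x, π.dirMap x d ∈ D.dirSet (π.toFun x) := fun d hd => by
    simpa [dirSet] using π.dirMap_isDir x d (by simpa [dirSet] using hd)
  rw [← Finset.sum_fiberwise_of_maps_to hmaps, Finset.mul_sum]
  refine Finset.sum_congr rfl fun d' hd' => ?_
  rw [π.localDeg_spec x d' (by simpa [dirSet] using hd'), Nat.cast_sum, Finset.sum_mul]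
  exact Finset.sum_congr rfl fun d hd => by rw [(Finset.mem_filter.mp hd).2]

theorem fiberDiv_apply (y : D.Space) (z : G.Space) :
    π.fiberDiv y z = π.localDeg z * if π.toFun z = y then 1 else 0 := by
  simp [fiberDiv, fiber, Finsupp.finsetSum_apply, Finsupp.single_apply]

theorem effective_fiberDiv (y : D.Space) : G.Effective (π.fiberDiv y) := fun z => by
  rw [fiberDiv_apply]
  split_ifs <;> simp

theorem linEquiv_fiberDiv {x y : D.Space} (h : PtEquiv x y) :
    G.LinEquiv (π.fiberDiv x) (π.fiberDiv y) := by
  obtain ⟨F, σ, hF, hσ⟩ := h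
  have hs := π.hasSlopes_comp hF
  refine ⟨hs.toRatFn, fun z => ?_⟩
  rw [HasSlopes.ordAt_eq (f := hs.toRatFn) hs, ← Int.cast_sum, sum_slopes_comp, hσ,
    Finsupp.sub_apply, fiberDiv_apply, fiberDiv_apply, mul_sub]

end TropCover

/-- if the target of a tropical admissible cover is a metric tree,
then the pullback of any point divisor `[x]` has rank at least `1`. -/
theorem rank_pullback_point_of_tree (Γ Δ : CombGraph)
    (hΓc : CompactSpace Γ.Space) (hΓ : ConnectedSpace Γ.Space)
    (hΔc : CompactSpace Δ.Space) (hΔ : ConnectedSpace Δ.Space)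
    (π : TropCover Γ Δ) (htree : Δ.genus = 0) (x : Δ.Space) :
    1 ≤ Γ.Rk (π.fiberDiv x) := by
  refine CombGraph.one_le_rk (π.effective_fiberDiv x) fun y => ?_
  refine ⟨π.fiberDiv (π.toFun y) - Finsupp.single y 1, fun z => ?_, ?_⟩
  · by_cases hz : y = z
    · subst hz
      have := π.localDeg_pos y
      simp only [Finsupp.sub_apply, π.fiberDiv_apply, Finsupp.single_eq_same, if_true]
      omega
    · simpa [Finsupp.single_apply, hz] using π.effective_fiberDiv (π.toFun y) z
  · obtain ⟨f, hf⟩ := π.linEquiv_fiberDiv (CombGraph.ptEquiv_of_genus_eq_zero htree x (π.toFun y))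
    exact ⟨f, by rwa [sub_sub_sub_cancel_right]⟩
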